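/- arXiv:2302.00145 — 5 statements merged into one kernel-verified Lean document; each statement's English description precedes it below -/
import Mathlib

section
/- For every k ∈ ℕ, every g ∈ G and every control sequence u ∈ U^ℕ, the solution of a discrete-time linear control system satisfies sol(k, g, u) = sol(k, e, u) · φᵏ(g). -/
/-- Solution of a discrete-time control system `x_{k+1} = f_{u_k}(x_k)`. -/
def dlsSol {M V : Type*} (f : V → M → M) : ℕ → M → (ℕ → V) → M
  | 0, p, _ => p
  | k + 1, p, u => f (u k) (dlsSol f k p u)

/-- For a discrete-time linear control system `g_{k+1} = b(u_k) · φ(g_k)` on a group `G`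
(with `b 0 = 1`), the solution satisfies `sol(k, g, u) = sol(k, e, u) · φᵏ(g)`. -/
theorem dls_solution_translation {G : Type*} [Group G] {V : Type*} [Zero V]
    (φ : MulAut G) (b : V → G) (hb0 : b 0 = 1) :
    ∀ (k : ℕ) (g : G) (u : ℕ → V),
      dlsSol (fun v x => b v * φ x) k g u
        = dlsSol (fun v x => b v * φ x) k 1 u * (φ ^ k) g := by
  intro k g u
  induction k with
  | zero => simp [dlsSol]
  | succ k ih =>
    simp only [dlsSol]
    rw [ih, map_mul, pow_succ', MulAut.mul_apply, mul_assoc]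
end

section
/- Let the reversed system of a discrete-time linear control system be the linear system with maps f̃_u(h) := φ⁻¹(b(u)⁻¹ · h) (i.e., with automorphism φ⁻¹ and translations b̃(u) = φ⁻¹(b(u)⁻¹)), and let R_k* and C_k* denote its reachable and controllable sets at time k from the identity. Then R_k* = C_k and R_k = C_k* for every k ≥ 1. -/
theorem dlsSol_succ' {M V : Type*} (f : V → M → M) (k : ℕ) (p : M) (u : ℕ → V) :
    dlsSol f (k + 1) p u = dlsSol f k (f (u 0) p) (fun j => u (j + 1)) := by
  induction k with
  | zero => rfl
  | succ k ih => rw [dlsSol, ih, dlsSol]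

/-- Running an inverse system with the controls in reverse order undoes a trajectory. -/
theorem dlsSol_reverse {M V : Type*} {f g : V → M → M} (h : ∀ v, Function.LeftInverse (g v) (f v))
    (k : ℕ) (p : M) (u : ℕ → V) :
    dlsSol g k (dlsSol f k p u) (fun j => u (k - 1 - j)) = p := by
  induction k with
  | zero => rfl
  | succ k ih =>
    rw [dlsSol_succ', dlsSol]
    simpa [h (u k) _, Nat.sub_sub, Nat.add_comm] using ih

theorem dlsSol_reachable_eq_controllable {M V : Type*} {f g : V → M → M}
    (hgf : ∀ v, Function.LeftInverse (g v) (f v)) (hfg : ∀ v, Function.LeftInverse (f v) (g v))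
    (k : ℕ) (p : M) :
    {h : M | ∃ u : ℕ → V, dlsSol f k p u = h} = {h : M | ∃ u : ℕ → V, dlsSol g k h u = p} := by
  ext h
  constructor
  · rintro ⟨u, rfl⟩
    exact ⟨_, dlsSol_reverse hgf k p u⟩
  · rintro ⟨u, rfl⟩
    exact ⟨_, dlsSol_reverse hfg k h u⟩

/-- For a discrete-time linear control system `g_{k+1} = b(u_k) · φ(g_k)` on a group `G`
(with `b 0 = 1`), consider the reversed system `h_{k+1} = φ⁻¹(b(u_k)⁻¹ · h_k)`.
Then, for all `k ≥ 1`, the reachable set at time `k` from the identity of the reversed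
system equals the controllable set `C_k` of the original system, and the reachable set
`R_k` of the original system equals the controllable set at time `k` of the reversed
system. -/
theorem dls_reversed_system_reachable_controllable
    {G : Type*} [Group G] {V : Type*} [Zero V]
    (φ : MulAut G) (b : V → G) (hb0 : b 0 = 1) :
    ∀ k : ℕ, 1 ≤ k →
      ({h : G | ∃ u : ℕ → V, dlsSol (fun v x => φ⁻¹ ((b v)⁻¹ * x)) k 1 u = h}
          = {h : G | ∃ u : ℕ → V, dlsSol (fun v x => b v * φ x) k h u = 1})
      ∧ ({h : G | ∃ u : ℕ → V, dlsSol (fun v x => b v * φ x) k 1 u = h}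
          = {h : G | ∃ u : ℕ → V, dlsSol (fun v x => φ⁻¹ ((b v)⁻¹ * x)) k h u = 1}) := by
  intro k _
  have hgf (v : V) : Function.LeftInverse (fun x => φ⁻¹ ((b v)⁻¹ * x)) (fun x => b v * φ x) :=
    fun x => by simp
  have hfg (v : V) : Function.LeftInverse (fun x => b v * φ x) (fun x => φ⁻¹ ((b v)⁻¹ * x)) :=
    fun x => by simp
  exact ⟨dlsSol_reachable_eq_controllable hfg hgf k 1,
    dlsSol_reachable_eq_controllable hgf hfg k 1⟩
end

section
/- Let g ∈ R be such that φᵏ(g) ∈ R for all k ∈ ℤ (where φᵏ denotes the k-th iterate of the automorphism φ, with negative iterates given by φ⁻¹). Then R · g ⊆ R, i.e., h·g ∈ R for every h ∈ R. -/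
/-- The solution at time `k` depends only on the controls before time `k`. -/
theorem dlsSol_congr {M V : Type*} (f : V → M → M) (p : M) {u v : ℕ → V} (k : ℕ)
    (huv : ∀ j < k, u j = v j) : dlsSol f k p u = dlsSol f k p v := by
  induction k with
  | zero => rfl
  | succ k ih =>
    simp only [dlsSol]
    rw [huv k k.lt_succ_self, ih fun j hj => huv j (hj.trans k.lt_succ_self)]

/-- Following `v` for time `t` and then `u` for time `k` is following their concatenation. -/
theorem dlsSol_concat {M V : Type*} (f : V → M → M) (p : M) (u v : ℕ → V) (t k : ℕ) :
    dlsSol f (t + k) p (fun j => if j < t then v j else u (j - t)) =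
      dlsSol f k (dlsSol f t p v) u := by
  induction k with
  | zero => exact dlsSol_congr f p t fun j hj => if_pos hj
  | succ k ih =>
    rw [← Nat.add_assoc]
    simp only [dlsSol, ih]
    simp

/-- The solution of a linear system from `x` is the solution from `1` times `φᵏ(x)`. -/
theorem dlsSol_linear_eq_mul {G V : Type*} [Group G] (φ : MulAut G) (b : V → G) (x : G)
    (u : ℕ → V) (k : ℕ) :
    dlsSol (fun v x => b v * φ x) k x u =
      dlsSol (fun v x => b v * φ x) k 1 u * (φ ^ k) x := by
  induction k with
  | zero => simp [dlsSol]
  | succ k ih =>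
    simp only [dlsSol]
    rw [ih, map_mul, pow_succ', MulAut.mul_apply, mul_assoc]

/-- For a discrete-time linear control system `g_{k+1} = b(u_k) · φ(g_k)` on a group `G`
(with `b 0 = 1`): if `g ∈ R` is such that `φᵏ(g) ∈ R` for every `k ∈ ℤ`, then
`R · g ⊆ R`. -/
theorem dls_reachable_right_translation
    {G : Type*} [Group G] {V : Type*} [Zero V]
    (φ : MulAut G) (b : V → G) (hb0 : b 0 = 1) (g : G)
    (hgR : g ∈ {h : G | ∃ k : ℕ, 1 ≤ k ∧
        ∃ u : ℕ → V, dlsSol (fun v x => b v * φ x) k 1 u = h})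
    (hg : ∀ k : ℤ, (φ ^ k) g ∈ {h : G | ∃ k : ℕ, 1 ≤ k ∧
        ∃ u : ℕ → V, dlsSol (fun v x => b v * φ x) k 1 u = h}) :
    ∀ h ∈ {h : G | ∃ k : ℕ, 1 ≤ k ∧
        ∃ u : ℕ → V, dlsSol (fun v x => b v * φ x) k 1 u = h},
      h * g ∈ {h : G | ∃ k : ℕ, 1 ≤ k ∧
        ∃ u : ℕ → V, dlsSol (fun v x => b v * φ x) k 1 u = h} := by
  rintro h ⟨k, -, u, rfl⟩
  obtain ⟨t, ht, v, hv⟩ := hg (-k)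
  refine ⟨t + k, by omega, fun j => if j < t then v j else u (j - t), ?_⟩
  rw [dlsSol_concat, hv, dlsSol_linear_eq_mul, ← MulAut.mul_apply, ← zpow_natCast,
    ← zpow_add]
  simp
end

section
/- The linear control system on the affine group Aff(2,ℝ) given by f_u(x,y) = (h(u)x, a(x−1) + dy + g(u)x) is accessible (both forward and backward accessible) if h'(0) ≠ 0 and −a·h'(0) ≠ g'(0)·(d−1), where h'(0) and g'(0) denote the derivatives of h and g at 0. -/
/-- The maps of the linear control system on `Aff(2,ℝ) = {(x,y) : x > 0}`:
`f_u(x,y) = (h(u)x, a(x−1) + dy + g(u)x)`. -/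
def affF (a d : ℝ) (h g : ℝ → ℝ) (u : ℝ) (p : ℝ × ℝ) : ℝ × ℝ :=
  (h u * p.1, a * (p.1 - 1) + d * p.2 + g u * p.1)

/-- A set containing `(φ (u, v), ψ (u, v))` for all `u, v` in a neighbourhood of `0` has nonempty
interior when the Jacobian determinant of `(φ, ψ)` at the origin does not vanish. -/
lemma interior_nonempty_of_jacobian_ne_zero {φ ψ : ℝ × ℝ → ℝ} {φ' ψ' : ℝ × ℝ →L[ℝ] ℝ}
    (hφ : HasStrictFDerivAt φ φ' (0, 0)) (hψ : HasStrictFDerivAt ψ ψ' (0, 0))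
    (hdet : φ' (1, 0) * ψ' (0, 1) - φ' (0, 1) * ψ' (1, 0) ≠ 0)
    {U : Set ℝ} (hU : U ∈ nhds (0 : ℝ)) {S : Set (ℝ × ℝ)}
    (hS : ∀ u ∈ U, ∀ v ∈ U, (φ (u, v), ψ (u, v)) ∈ S) : (interior S).Nonempty := by
  have hsurj : (φ'.prod ψ').range = ⊤ := by
    rw [LinearMap.range_eq_top]
    rintro ⟨s, t⟩
    have key : ∀ L : ℝ × ℝ →L[ℝ] ℝ, ∀ b c : ℝ, L (b, c) = b * L (1, 0) + c * L (0, 1) := by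
      intro L b c
      have h : ((b, c) : ℝ × ℝ) = b • (1, 0) + c • (0, 1) := by simp
      rw [h, map_add, map_smul, map_smul, smul_eq_mul, smul_eq_mul]
    refine ⟨((s * ψ' (0, 1) - t * φ' (0, 1)) / (φ' (1, 0) * ψ' (0, 1) - φ' (0, 1) * ψ' (1, 0)),
      (t * φ' (1, 0) - s * ψ' (1, 0)) / (φ' (1, 0) * ψ' (0, 1) - φ' (0, 1) * ψ' (1, 0))), ?_⟩
    change (φ' _, ψ' _) = _
    rw [key φ' (_ / _), key ψ' (_ / _), Prod.mk.injEq]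
    constructor <;>
      rw [div_mul_eq_mul_div, div_mul_eq_mul_div, ← add_div, div_eq_iff hdet] <;> ring
  refine ⟨(φ (0, 0), ψ (0, 0)), mem_interior_iff_mem_nhds.2 ?_⟩
  have hmap := (hφ.prodMk hψ).map_nhds_eq_of_surj hsurj
  rw [← hmap, Filter.mem_map]
  filter_upwards [prod_mem_nhds hU hU] with w hw
  exact hS w.1 hw.1 w.2 hw.2

/-- Two steps of the system, driven by the constant-after-one control `u, v, v, …`. -/
lemma dlsSol_two {M V : Type*} (f : V → M → M) (p : M) (u v : V) :
    dlsSol f 2 p (fun j => if j = 0 then u else v) = f v (f u p) := by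
  simp [dlsSol]

/-- The linear control system on `Aff(2,ℝ)` given by
`f_u(x,y) = (h(u)x, a(x−1) + dy + g(u)x)` is accessible (both forward and backward
accessible) if `h'(0) ≠ 0` and `−a·h'(0) ≠ g'(0)·(d−1)`. -/
theorem aff_system_accessible
    (a d : ℝ) (hd : d ≠ 0) (h g : ℝ → ℝ)
    (hsmooth : ContDiff ℝ (⊤ : ℕ∞) h) (gsmooth : ContDiff ℝ (⊤ : ℕ∞) g)
    (hpos : ∀ u : ℝ, 0 < h u) (h0 : h 0 = 1) (g0 : g 0 = 0)
    (U : Set ℝ) (hUcomp : IsCompact U) (hUconv : Convex ℝ U) (hU0 : U ∈ nhds 0)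
    (hder : deriv h 0 ≠ 0) (hcond : -(a * deriv h 0) ≠ deriv g 0 * (d - 1)) :
    (∀ p : ℝ × ℝ, 0 < p.1 →
      (interior {q : ℝ × ℝ | ∃ k : ℕ, 1 ≤ k ∧ ∃ u : ℕ → ℝ,
        (∀ j, u j ∈ U) ∧ dlsSol (affF a d h g) k p u = q}).Nonempty)
    ∧ (∀ p : ℝ × ℝ, 0 < p.1 →
      (interior {q : ℝ × ℝ | ∃ k : ℕ, 1 ≤ k ∧ ∃ u : ℕ → ℝ,
        (∀ j, u j ∈ U) ∧ dlsSol (affF a d h g) k q u = p}).Nonempty) := by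
  have hh : HasStrictDerivAt h (deriv h 0) 0 :=
    hsmooth.contDiffAt.hasStrictDerivAt (by simp)
  have hg : HasStrictDerivAt g (deriv g 0) 0 :=
    gsmooth.contDiffAt.hasStrictDerivAt (by simp)
  have hfst : HasStrictFDerivAt (Prod.fst : ℝ × ℝ → ℝ) (ContinuousLinearMap.fst ℝ ℝ ℝ) (0, 0) :=
    hasStrictFDerivAt_fst
  have hsnd : HasStrictFDerivAt (Prod.snd : ℝ × ℝ → ℝ) (ContinuousLinearMap.snd ℝ ℝ ℝ) (0, 0) :=
    hasStrictFDerivAt_snd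
  have gu := HasStrictDerivAt.comp_hasStrictFDerivAt (0, 0) hg hfst
  have gv := HasStrictDerivAt.comp_hasStrictFDerivAt (0, 0) hg hsnd
  have hcond' : a * deriv h 0 + deriv g 0 * (d - 1) ≠ 0 := fun H => hcond (by linarith)
  refine ⟨fun p hp => ?_, fun p hp => ?_⟩
  · have hu := HasStrictDerivAt.comp_hasStrictFDerivAt (0, 0) hh hfst
    have hv := HasStrictDerivAt.comp_hasStrictFDerivAt (0, 0) hh hsnd
    refine interior_nonempty_of_jacobian_ne_zero ((hv.mul hu).mul_const p.1)
      (((gv.const_add a).mul (hu.mul_const p.1)).add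
        (((gu.const_add a).mul_const p.1).const_mul d)
        |>.add_const (-a + d * (d * p.2 - a))) ?_ hU0 ?_
    · have : -(deriv h 0 * p.1 ^ 2 * (a * deriv h 0 + deriv g 0 * (d - 1))) ≠ 0 := by
        simp [hder, hp.ne', hcond']
      convert this using 1
      simp [h0, g0]
      ring
    · intro u hu v hv
      refine ⟨2, by norm_num, fun j => if j = 0 then u else v, fun j => ?_, ?_⟩
      · dsimp only
        split_ifs <;> assumption
      · rw [dlsSol_two]
        simp only [affF, Function.comp_apply, Pi.mul_apply, Pi.add_apply, Prod.mk.injEq]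
        constructor <;> ring
  · have hi := (hasStrictDerivAt_inv (hpos 0).ne').comp 0 hh
    have iu := HasStrictDerivAt.comp_hasStrictFDerivAt (0, 0) hi hfst
    have iv := HasStrictDerivAt.comp_hasStrictFDerivAt (0, 0) hi hsnd
    refine interior_nonempty_of_jacobian_ne_zero ((iu.mul iv).mul_const p.1)
      ((((((gv.const_add a).mul iv).mul_const p.1).add
        ((((gu.const_add a).mul (iu.mul iv)).mul_const p.1).const_mul d)).const_sub
          (p.2 + a + d * a)).const_mul (d ^ 2)⁻¹) ?_ hU0 ?_
    · have : -(deriv h 0 * p.1 ^ 2 * (d ^ 2)⁻¹ * (a * deriv h 0 + deriv g 0 * (d - 1))) ≠ 0 := by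
        simp [hd, hder, hp.ne', hcond']
      convert this using 1
      simp [h0, g0]
      ring
    · intro u hu v hv
      have hu' := (hpos u).ne'
      have hv' := (hpos v).ne'
      refine ⟨2, by norm_num, fun j => if j = 0 then u else v, fun j => ?_, ?_⟩
      · dsimp only
        split_ifs <;> assumption
      · rw [dlsSol_two]
        ext
        · simp [affF]
          field_simp
        · simp [affF]
          field_simp
          ring
end

section
/- If h'(0) ≠ 0, −a·h'(0) ≠ g'(0)·(d−1), and d = 1, then the linear control system on Aff(2,ℝ) given by f_u(x,y) = (h(u)x, a(x−1) + dy + g(u)x) is controllable: for all p, q ∈ Aff(2,ℝ) there exist k ≥ 1 and u ∈ U^ℕ with sol(k,p,u) = q. -/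
theorem exists_controls_of_transGen {M V : Type*} {f : V → M → M} {U : Set V}
    {p q : M}
    (hpq : Relation.TransGen (fun x y => ∃ v ∈ U, f v x = y) p q) :
    ∃ k : ℕ, 1 ≤ k ∧ ∃ u : ℕ → V, (∀ j, u j ∈ U) ∧ dlsSol f k p u = q := by
  have congr_lt : ∀ (k : ℕ) (u w : ℕ → V), (∀ j < k, u j = w j) →
      dlsSol f k p u = dlsSol f k p w := by
    intro k
    induction k with
    | zero => intros; rfl
    | succ k ih =>
      intro u w huw
      simp only [dlsSol]
      rw [huw k (Nat.lt_succ_self k), ih u w fun j hj => huw j (hj.trans (Nat.lt_succ_self k))]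
  induction hpq with
  | single hstep =>
    obtain ⟨v, hv, rfl⟩ := hstep
    exact ⟨1, le_rfl, fun _ => v, fun _ => hv, rfl⟩
  | tail _ hstep ih =>
    obtain ⟨k, -, u, hu, rfl⟩ := ih
    obtain ⟨v, hv, rfl⟩ := hstep
    refine ⟨k + 1, k.succ_pos, Function.update u k v, fun j => ?_, ?_⟩
    · by_cases hj : j = k
      · subst hj; simpa using hv
      · simpa [hj] using hu j
    · simp only [dlsSol, Function.update_self]
      rw [congr_lt k _ u fun j hj => Function.update_of_ne hj.ne _ _]

theorem reflTransGen_iterate {M V : Type*} (f : V → M → M) {U : Set V} {v : V} (hv : v ∈ U)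
    (n : ℕ) (p : M) :
    Relation.ReflTransGen (fun x y => ∃ v ∈ U, f v x = y) p ((f v)^[n] p) := by
  induction n with
  | zero => exact .refl
  | succ n ih =>
    rw [Function.iterate_succ_apply']
    exact ih.tail ⟨v, hv, rfl⟩

theorem affF_iterate_fst (a d : ℝ) (h g : ℝ → ℝ) (u : ℝ) (n : ℕ) (p : ℝ × ℝ) :
    ((affF a d h g u)^[n] p).1 = h u ^ n * p.1 := by
  induction n with
  | zero => simp
  | succ n ih =>
    rw [Function.iterate_succ_apply', affF, ih]
    ring

theorem affF_one_iterate_add (a : ℝ) (h g : ℝ → ℝ) (u c : ℝ) (n : ℕ) (p : ℝ × ℝ) :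
    (affF a 1 h g u)^[n] (p + (0, c)) = (affF a 1 h g u)^[n] p + (0, c) := by
  have hcomm : Function.Commute (affF a 1 h g u) (· + ((0, c) : ℝ × ℝ)) := by
    intro p
    ext <;> simp [affF]
    ring
  exact hcomm.iterate_left n p

theorem affF_one_zero_iterate (a : ℝ) {h g : ℝ → ℝ} (h0 : h 0 = 1) (g0 : g 0 = 0) (n : ℕ)
    (p : ℝ × ℝ) : (affF a 1 h g 0)^[n] p = p + (0, n * (a * (p.1 - 1))) := by
  induction n with
  | zero => simp
  | succ n ih =>
    rw [Function.iterate_succ_apply', ih]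
    ext <;> simp [affF, h0, g0]
    ring

theorem ContinuousOn.affF_iterate {a d : ℝ} {h g : ℝ → ℝ} (hh : Continuous h) (hg : Continuous g)
    {s : Set ℝ} {u : ℝ → ℝ} {p : ℝ → ℝ × ℝ} (hu : ContinuousOn u s) (hp : ContinuousOn p s)
    (n : ℕ) : ContinuousOn (fun t => (affF a d h g (u t))^[n] (p t)) s := by
  induction n with
  | zero => exact hp
  | succ n ih =>
    simp only [Function.iterate_succ_apply', affF]
    have hhu := hh.comp_continuousOn hu
    have hgu := hg.comp_continuousOn hu
    exact (hhu.mul ih.fst).prodMk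
      (((continuousOn_const.mul (ih.fst.sub continuousOn_const)).add
        (continuousOn_const.mul ih.snd)).add (hgu.mul ih.fst))

/-- Near `0`, the equation `h u = exp s` is solved by a continuous function of `s` valued in `U`. -/
theorem exists_continuousOn_exp_section {h : ℝ → ℝ} (hh : ContDiff ℝ (⊤ : ℕ∞) h) (h0 : h 0 = 1)
    (hder : deriv h 0 ≠ 0) {U : Set ℝ} (hU : U ∈ nhds 0) :
    ∃ ε > 0, ∃ ψ : ℝ → ℝ, ContinuousOn ψ (Metric.ball 0 ε) ∧
      ∀ s ∈ Metric.ball (0 : ℝ) ε, ψ s ∈ U ∧ h (ψ s) = Real.exp s := by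
  have hs : HasStrictDerivAt h (deriv h 0) 0 :=
    hh.contDiffAt.hasStrictDerivAt (by simp)
  have hs' := hs.hasStrictFDerivAt_equiv hder
  let e := hs'.toOpenPartialHomeomorph h
  have he : (e : ℝ → ℝ) = h := hs'.toOpenPartialHomeomorph_coe
  have hsrc : (0 : ℝ) ∈ e.source := hs'.mem_toOpenPartialHomeomorph_source
  have htgt : (1 : ℝ) ∈ e.target := by
    have := e.map_source hsrc
    rwa [he, h0] at this
  have hsymm : e.symm 1 = 0 := by
    have := e.left_inv hsrc
    rwa [he, h0] at this
  have hmem : e.target ∩ e.symm ⁻¹' U ∈ nhds (Real.exp 0) := by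
    rw [Real.exp_zero]
    refine Filter.inter_mem (e.open_target.mem_nhds htgt) ?_
    exact (e.continuousAt_symm htgt).preimage_mem_nhds (by rwa [hsymm])
  obtain ⟨ε, hε, hball⟩ :=
    Metric.mem_nhds_iff.1 (Real.continuous_exp.continuousAt.preimage_mem_nhds hmem)
  refine ⟨ε, hε, fun s => e.symm (Real.exp s), ?_, fun s hs => ⟨(hball hs).2, ?_⟩⟩
  · exact e.continuousOn_symm.comp Real.continuous_exp.continuousOn fun s hs => (hball hs).1
  · have := e.right_inv (hball hs).1
    rwa [he] at this

/-- A large multiple of a function changing sign dominates any continuous perturbation. -/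
theorem exists_nat_exists_add_mul_eq {C φ : ℝ → ℝ} {l r : ℝ} (hlr : l ≤ r)
    (hC : ContinuousOn C (Set.Icc l r)) (hφ : ContinuousOn φ (Set.Icc l r))
    (hsign : φ l * φ r < 0) (c : ℝ) :
    ∃ m : ℕ, ∃ t ∈ Set.Icc l r, C t + m * φ t = c := by
  have hcont : ∀ m : ℕ, ContinuousOn (fun t => C t + m * φ t) (Set.Icc l r) := fun m =>
    hC.add (continuousOn_const.mul hφ)
  have large : ∀ b x : ℝ, 0 < x → ∀ᶠ m : ℕ in Filter.atTop, b ≤ m * x := fun b x hx =>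
    (tendsto_natCast_atTop_atTop.atTop_mul_const hx).eventually_ge_atTop b
  rcases mul_neg_iff.1 hsign with ⟨hl, hr⟩ | ⟨hl, hr⟩
  · obtain ⟨m, h1, h2⟩ :=
      ((large (c - C l) _ hl).and (large (C r - c) (-φ r) (neg_pos.2 hr))).exists
    obtain ⟨t, ht, h⟩ := intermediate_value_Icc' hlr (hcont m)
      (show c ∈ Set.Icc _ _ from ⟨by linarith, by linarith⟩)
    exact ⟨m, t, ht, h⟩
  · obtain ⟨m, h1, h2⟩ :=
      ((large (C l - c) (-φ l) (neg_pos.2 hl)).and (large (c - C r) _ hr)).exists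
    obtain ⟨t, ht, h⟩ := intermediate_value_Icc hlr (hcont m)
      (show c ∈ Set.Icc _ _ from ⟨by linarith, by linarith⟩)
    exact ⟨m, t, ht, h⟩

theorem affF_one_reflTransGen {a : ℝ} (ha : a ≠ 0) {h g : ℝ → ℝ}
    (hh : ContDiff ℝ (⊤ : ℕ∞) h) (hg : Continuous g) (h0 : h 0 = 1) (g0 : g 0 = 0)
    {U : Set ℝ} (hU : U ∈ nhds 0) (hder : deriv h 0 ≠ 0)
    {p q : ℝ × ℝ} (hp : 0 < p.1) (hq : 0 < q.1) :
    Relation.ReflTransGen (fun x y => ∃ v ∈ U, affF a 1 h g v x = y) p q := by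
  obtain ⟨ε, hε, ψ, hψ, hψU⟩ := exists_continuousOn_exp_section hh h0 hder hU
  obtain ⟨K, hK⟩ := exists_nat_gt ((1 + |Real.log p.1| + |Real.log q.1|) / ε)
  have hK0 : (0 : ℝ) < K := lt_of_le_of_lt (by positivity) hK
  rw [div_lt_iff₀ hε] at hK
  have hball : ∀ s : ℝ, |s| ≤ 1 + |Real.log p.1| + |Real.log q.1| →
      s / K ∈ Metric.ball (0 : ℝ) ε := by
    intro s hs
    rw [mem_ball_zero_iff, Real.norm_eq_abs, abs_div, abs_of_pos hK0, div_lt_iff₀ hK0]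
    linarith
  have hb₁ : Set.MapsTo (fun t : ℝ => (t - Real.log p.1) / K) (Set.Icc (-1) 1)
      (Metric.ball 0 ε) := fun t ht => hball _ <| by
    linarith [abs_sub t (Real.log p.1), abs_le.2 ht, abs_nonneg (Real.log q.1)]
  have hb₂ : Set.MapsTo (fun t : ℝ => (Real.log q.1 - t) / K) (Set.Icc (-1) 1)
      (Metric.ball 0 ε) := fun t ht => hball _ <| by
    linarith [abs_sub (Real.log q.1) t, abs_le.2 ht, abs_nonneg (Real.log p.1)]
  have hpow : ∀ s : ℝ, s / K ∈ Metric.ball (0 : ℝ) ε → h (ψ (s / K)) ^ K = Real.exp s := by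
    intro s hs
    rw [(hψU _ hs).2, ← Real.exp_nat_mul, mul_div_cancel₀ _ hK0.ne']
  let P : ℝ → ℝ × ℝ := fun t => (affF a 1 h g (ψ ((t - Real.log p.1) / K)))^[K] p
  have hP1 : ∀ t ∈ Set.Icc (-1 : ℝ) 1, (P t).1 = Real.exp t := by
    intro t ht
    rw [affF_iterate_fst, hpow _ (hb₁ ht), Real.exp_sub, Real.exp_log hp,
      div_mul_cancel₀ _ hp.ne']
  let Q : ℝ → ℝ × ℝ := fun t => (affF a 1 h g (ψ ((Real.log q.1 - t) / K)))^[K] (P t)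
  have hQ1 : ∀ t ∈ Set.Icc (-1 : ℝ) 1, (Q t).1 = q.1 := by
    intro t ht
    rw [affF_iterate_fst, hpow _ (hb₂ ht), hP1 t ht, Real.exp_sub, Real.exp_log hq,
      div_mul_cancel₀ _ (Real.exp_pos t).ne']
  have hPcont : ContinuousOn P (Set.Icc (-1) 1) :=
    ContinuousOn.affF_iterate hh.continuous hg
      (hψ.comp (by fun_prop) hb₁) continuousOn_const K
  have hQcont : ContinuousOn Q (Set.Icc (-1) 1) :=
    ContinuousOn.affF_iterate hh.continuous hg (hψ.comp (by fun_prop) hb₂) hPcont K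
  have hsign : a * (Real.exp (-1) - 1) * (a * (Real.exp 1 - 1)) < 0 := by
    have h1 : Real.exp (-1) - 1 < 0 := sub_neg.2 (Real.exp_lt_one_iff.2 (by norm_num))
    have h2 : 0 < Real.exp 1 - 1 := sub_pos.2 (Real.one_lt_exp_iff.2 one_pos)
    have h3 : 0 < a ^ 2 := by positivity
    nlinarith [mul_neg_of_neg_of_pos (mul_neg_of_pos_of_neg h3 h1) h2]
  obtain ⟨m, t, ht, hmt⟩ := exists_nat_exists_add_mul_eq (by norm_num) hQcont.snd
    (φ := fun t => a * (Real.exp t - 1)) (by fun_prop) hsign q.2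
  have hend : (affF a 1 h g (ψ ((Real.log q.1 - t) / K)))^[K]
      ((affF a 1 h g 0)^[m] (P t)) = q := by
    rw [affF_one_zero_iterate a h0 g0, affF_one_iterate_add, hP1 t ht]
    ext
    · simpa using hQ1 t ht
    · exact hmt
  rw [← hend]
  exact ((reflTransGen_iterate _ (hψU _ (hb₁ ht)).1 K p).trans
    (reflTransGen_iterate _ (mem_of_mem_nhds hU) m _)).trans
    (reflTransGen_iterate _ (hψU _ (hb₂ ht)).1 K _)

/-- If `h'(0) ≠ 0`, `−a·h'(0) ≠ g'(0)·(d−1)` and `d = 1`, then the linear control system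
on `Aff(2,ℝ)` given by `f_u(x,y) = (h(u)x, a(x−1) + dy + g(u)x)` is controllable. -/
theorem aff_system_controllable
    (a d : ℝ) (hd : d ≠ 0) (h g : ℝ → ℝ)
    (hsmooth : ContDiff ℝ (⊤ : ℕ∞) h) (gsmooth : ContDiff ℝ (⊤ : ℕ∞) g)
    (hpos : ∀ u : ℝ, 0 < h u) (h0 : h 0 = 1) (g0 : g 0 = 0)
    (U : Set ℝ) (hUcomp : IsCompact U) (hUconv : Convex ℝ U) (hU0 : U ∈ nhds 0)
    (hder : deriv h 0 ≠ 0) (hcond : -(a * deriv h 0) ≠ deriv g 0 * (d - 1))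
    (hd1 : d = 1) :
    ∀ p q : ℝ × ℝ, 0 < p.1 → 0 < q.1 →
      ∃ k : ℕ, 1 ≤ k ∧ ∃ u : ℕ → ℝ,
        (∀ j, u j ∈ U) ∧ dlsSol (affF a d h g) k p u = q := by
  subst hd1
  have ha : a ≠ 0 := by
    rintro rfl
    simp at hcond
  intro p q hp hq
  have hp' : 0 < (affF a 1 h g 0 p).1 := mul_pos (hpos 0) hp
  exact exists_controls_of_transGen (.head' ⟨0, mem_of_mem_nhds hU0, rfl⟩
    (affF_one_reflTransGen ha hsmooth gsmooth.continuous h0 g0 hU0 hder hp' hq))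
end
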